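/- arXiv:math/0212150 — 2 statements merged into one kernel-verified Lean document; each statement's English description precedes it below -/
import Mathlib

section
/- Left multiplication in the positive braid monoid preserves greatest common divisors: for all p, u, v ∈ B_n^+, if d is a greatest common left-divisor of u and v, then p d is a greatest common left-divisor of p u and p v. -/
/-- The braid relations on `n` strands, with Artin generators indexed by `Fin (n-1)`:
`σᵢ σⱼ σᵢ = σⱼ σᵢ σⱼ` when `|i - j| = 1`, and `σᵢ σⱼ = σⱼ σᵢ` when `|i - j| ≥ 2`. -/
def braidRels (n : ℕ) : Set (FreeGroup (Fin (n - 1))) :=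
  {w | (∃ i j : Fin (n - 1), (i : ℕ) + 1 = (j : ℕ) ∧
          w = FreeGroup.of i * FreeGroup.of j * FreeGroup.of i *
              (FreeGroup.of j * FreeGroup.of i * FreeGroup.of j)⁻¹) ∨
       (∃ i j : Fin (n - 1), (i : ℕ) + 1 < (j : ℕ) ∧
          w = FreeGroup.of i * FreeGroup.of j * (FreeGroup.of j * FreeGroup.of i)⁻¹)}

/-- The braid group `B_n` on `n` strands. -/
abbrev BraidGroup (n : ℕ) := PresentedGroup (braidRels n)

/-- The Artin generator `σᵢ` of the braid group. -/
def braidGen (n : ℕ) (i : Fin (n - 1)) : BraidGroup n := PresentedGroup.of i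

/-- The monoid `B_n⁺` of positive braids: products of the generators with no inverses. -/
def PosBraid (n : ℕ) : Submonoid (BraidGroup n) :=
  Submonoid.closure (Set.range (braidGen n))

/-- Prefix order (left-divisibility): `a ≼ b` iff `a * c = b` for some positive `c`. -/
def PrefixLE (n : ℕ) (a b : BraidGroup n) : Prop :=
  ∃ c ∈ PosBraid n, a * c = b

/-- The Garside half-twist `Δ = (σ₁)(σ₂σ₁)⋯(σ_{n-1}⋯σ₁)`. -/
def braidDelta (n : ℕ) : BraidGroup n :=
  ((List.finRange (n - 1)).map (fun k =>
      ((((List.finRange (n - 1)).filter (fun i => decide (i ≤ k))).reverse.map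
        (braidGen n)).prod))).prod

/-- A simple element (permutation braid): a positive braid left-dividing `Δ`. -/
def IsSimple (n : ℕ) (s : BraidGroup n) : Prop :=
  s ∈ PosBraid n ∧ PrefixLE n s (braidDelta n)

/-- `InfGE n j a` means `inf(a) ≥ j`, i.e. `a = Δ^j p` for some positive braid `p`. -/
def InfGE (n : ℕ) (j : ℤ) (a : BraidGroup n) : Prop :=
  ∃ p ∈ PosBraid n, a = braidDelta n ^ j * p

/-- `β ∈ C^inf(α)`: `inf(β i) ≥ inf(α i)` for all `i` and `β` is simultaneously
conjugate to `α`. -/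
def CInf (n r : ℕ) (α β : Fin r → BraidGroup n) : Prop :=
  (∀ i, ∀ j : ℤ, InfGE n j (α i) → InfGE n j (β i)) ∧
  ∃ ω : BraidGroup n, ∀ i, β i = ω⁻¹ * α i * ω

/-- `δ ∈ C_J`: `inf(δ i) ≥ J i` for all `i`. -/
def CJ (n r : ℕ) (J : Fin r → ℤ) (δ : Fin r → BraidGroup n) : Prop :=
  ∀ i, InfGE n (J i) (δ i)

/-- Property `P(δ,J)` for a braid `s`: `inf(s⁻¹ δᵢ s) ≥ J i` for all `i`,
i.e. `s⁻¹ δ s ∈ C_J`. -/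
def PropP (n r : ℕ) (J : Fin r → ℤ) (δ : Fin r → BraidGroup n) (s : BraidGroup n) : Prop :=
  ∀ i, InfGE n (J i) (s⁻¹ * δ i * s)

/-- `s ∈ S_{δ,J}`: `s` is ≼-minimal among the nontrivial simple elements
satisfying `P(δ,J)`. -/
def MinSimple (n r : ℕ) (J : Fin r → ℤ) (δ : Fin r → BraidGroup n) (s : BraidGroup n) : Prop :=
  IsSimple n s ∧ s ≠ 1 ∧ PropP n r J δ s ∧
    ∀ t : BraidGroup n, IsSimple n t → t ≠ 1 → PropP n r J δ t → PrefixLE n t s → t = s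

/-- `d` is a greatest common left-divisor of `u` and `v` in `B_n⁺`. -/
def IsGCD (n : ℕ) (u v d : BraidGroup n) : Prop :=
  d ∈ PosBraid n ∧ PrefixLE n d u ∧ PrefixLE n d v ∧
    ∀ c ∈ PosBraid n, PrefixLE n c u → PrefixLE n c v → PrefixLE n c d

/-- `m` is a least common left-multiple of `u` and `v` in `B_n⁺`. -/
def IsLCM (n : ℕ) (u v m : BraidGroup n) : Prop :=
  m ∈ PosBraid n ∧ PrefixLE n u m ∧ PrefixLE n v m ∧
    ∀ c ∈ PosBraid n, PrefixLE n u c → PrefixLE n v c → PrefixLE n m c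

/-- The braid relations, as relations between positive words in `m` generators. -/
def braidMonoidRels (m : ℕ) (x y : FreeMonoid (Fin m)) : Prop :=
  ∃ i j : Fin m,
    ((i : ℕ) + 1 = j ∧ x = .of i * .of j * .of i ∧ y = .of j * .of i * .of j) ∨
    ((i : ℕ) + 1 < j ∧ x = .of i * .of j ∧ y = .of j * .of i)

/-- The abstract monoid presented by `m` generators and the braid relations. -/
abbrev BraidMonoid (m : ℕ) := PresentedMonoid (braidMonoidRels m)

namespace BraidMonoid

variable {m : ℕ}

/-- The generators of the braid monoid. -/
def gen (i : Fin m) : BraidMonoid m := PresentedMonoid.of _ i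

/-- Indices of adjacent, hence braided, generators. -/
def Adj (i j : Fin m) : Prop := (i : ℕ) + 1 = j ∨ (j : ℕ) + 1 = i

instance (i j : Fin m) : Decidable (Adj i j) := inferInstanceAs (Decidable (_ ∨ _))

theorem Adj.symm {i j : Fin m} (h : Adj i j) : Adj j i := Or.symm h

theorem gen_braid {i j : Fin m} (h : Adj i j) :
    gen i * gen j * gen i = gen j * gen i * gen j := by
  rcases h with h | h
  · exact PresentedMonoid.mk_eq_mk_of_rel ⟨i, j, .inl ⟨h, rfl, rfl⟩⟩
  · exact (PresentedMonoid.mk_eq_mk_of_rel ⟨j, i, .inl ⟨h, rfl, rfl⟩⟩).symm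

theorem gen_comm {i j : Fin m} (h : ¬ Adj i j) : gen i * gen j = gen j * gen i := by
  rcases lt_trichotomy (i : ℕ) j with hij | hij | hij
  · exact PresentedMonoid.mk_eq_mk_of_rel
      ⟨i, j, .inr ⟨by unfold Adj at h; omega, rfl, rfl⟩⟩
  · rw [Fin.ext hij]
  · exact (PresentedMonoid.mk_eq_mk_of_rel
      ⟨j, i, .inr ⟨by unfold Adj at h; omega, rfl, rfl⟩⟩).symm

/-- The word length on the braid monoid, as a monoid homomorphism. -/
def lengthHom (m : ℕ) : BraidMonoid m →* Multiplicative ℕ :=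
  PresentedMonoid.lift (fun _ => Multiplicative.ofAdd 1) (by
    rintro a b ⟨i, j, ⟨-, rfl, rfl⟩ | ⟨-, rfl, rfl⟩⟩ <;> simp)

/-- The word length on the braid monoid. -/
def length (a : BraidMonoid m) : ℕ := (lengthHom m a).toAdd

@[simp] theorem length_one : length (1 : BraidMonoid m) = 0 := by simp [length]

@[simp] theorem length_mul (a b : BraidMonoid m) : length (a * b) = length a + length b := by
  simp [length]

@[simp] theorem length_gen (i : Fin m) : length (gen i) = 1 := rfl

theorem eq_one_or_gen_mul (a : BraidMonoid m) : a = 1 ∨ ∃ i b, a = gen i * b := by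
  induction a using PresentedMonoid.inductionOn with | _ a
  induction a with
  | one => exact .inl rfl
  | of x => exact .inr ⟨x, 1, (mul_one _).symm⟩
  | mul x y hx hy =>
    rw [map_mul]
    rcases hx with hx | ⟨i, b, hx⟩
    · simpa [hx] using hy
    · exact .inr ⟨i, b * _, by rw [hx, mul_assoc]⟩

/-- The complement of `gen i` in the least common multiple of `gen i` and `gen j`. -/
def compl (i j : Fin m) : BraidMonoid m :=
  if i = j then 1 else if Adj i j then gen j * gen i else gen j

theorem compl_self (i : Fin m) : compl i i = 1 := if_pos rfl

theorem compl_of_adj {i j : Fin m} (h : Adj i j) : compl i j = gen j * gen i := by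
  have : i ≠ j := by rintro rfl; unfold Adj at h; omega
  simp [compl, this, h]

theorem compl_of_not_adj {i j : Fin m} (hij : i ≠ j) (h : ¬ Adj i j) : compl i j = gen j := by
  simp [compl, hij, h]

theorem gen_mul_compl (i j : Fin m) : gen i * compl i j = gen j * compl j i := by
  by_cases hij : i = j
  · rw [hij]
  by_cases h : Adj i j
  · rw [compl_of_adj h, compl_of_adj h.symm, ← mul_assoc, ← mul_assoc, gen_braid h]
  · rw [compl_of_not_adj hij h, compl_of_not_adj (Ne.symm hij) (fun h' => h h'.symm), gen_comm h]

theorem commute_compl {i j : Fin m} {a : BraidMonoid m} (hi : Commute a (gen i))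
    (hj : Commute a (gen j)) : Commute a (compl i j) := by
  unfold compl
  split_ifs
  · exact Commute.one_right a
  · exact hj.mul_right hi
  · exact hj

/-- `gen i * a` and `gen j * b` are the same multiple of the least common multiple of
`gen i` and `gen j`. -/
def FactorsThroughLCM (i j : Fin m) (a b : BraidMonoid m) : Prop :=
  ∃ c, a = compl i j * c ∧ b = compl j i * c

theorem FactorsThroughLCM.symm {i j : Fin m} {a b : BraidMonoid m}
    (h : FactorsThroughLCM i j a b) : FactorsThroughLCM j i b a := by
  obtain ⟨c, hc⟩ := h
  exact ⟨c, hc.symm⟩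

theorem factorsThroughLCM_self (i : Fin m) (a : BraidMonoid m) : FactorsThroughLCM i i a a :=
  ⟨a, by simp [compl_self]⟩

theorem factorsThroughLCM_self_iff {i : Fin m} {a b : BraidMonoid m} :
    FactorsThroughLCM i i a b ↔ a = b := by
  refine ⟨fun ⟨c, ha, hb⟩ => ha.trans hb.symm, ?_⟩
  rintro rfl
  exact factorsThroughLCM_self i a

theorem factorsThroughLCM_of_adj {i j : Fin m} (h : Adj i j) {a b : BraidMonoid m} :
    FactorsThroughLCM i j a b ↔ ∃ c, a = gen j * (gen i * c) ∧ b = gen i * (gen j * c) := by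
  simp only [FactorsThroughLCM, compl_of_adj h, compl_of_adj h.symm, mul_assoc]

theorem factorsThroughLCM_of_not_adj {i j : Fin m} (hij : i ≠ j) (h : ¬ Adj i j)
    {a b : BraidMonoid m} :
    FactorsThroughLCM i j a b ↔ ∃ c, a = gen j * c ∧ b = gen i * c := by
  have h' : ¬ Adj j i := fun h' => h h'.symm
  simp only [FactorsThroughLCM, compl_of_not_adj hij h, compl_of_not_adj hij.symm h']

/-- Equal products of a generator with a shorter element than `N` factor through the least
common multiple of the two generators. -/
def HasLCMBelow (m N : ℕ) : Prop :=
  ∀ (i j : Fin m) (a b : BraidMonoid m), length a < N → gen i * a = gen j * b →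
    FactorsThroughLCM i j a b

theorem HasLCMBelow.cancel {N : ℕ} (hN : HasLCMBelow m N) {i : Fin m} {a b : BraidMonoid m}
    (ha : length a < N) (h : gen i * a = gen i * b) : a = b :=
  factorsThroughLCM_self_iff.1 (hN i i a b ha h)

theorem HasLCMBelow.cancel_compl {N : ℕ} (hN : HasLCMBelow m N) (i j : Fin m)
    {a b : BraidMonoid m} (ha : length (compl i j * a) ≤ N)
    (h : compl i j * a = compl i j * b) : a = b := by
  by_cases hij : i = j
  · simpa [hij, compl_self] using h
  by_cases hadj : Adj i j
  · simp only [compl_of_adj hadj, mul_assoc, length_mul, length_gen] at h ha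
    exact hN.cancel (by omega) (hN.cancel (by simp; omega) h)
  · simp only [compl_of_not_adj hij hadj, length_mul, length_gen] at h ha
    exact hN.cancel (by omega) h

theorem word_eq_of_comm_braid_braid {M : Type*} [Monoid M] {s t r : M} (st : s * t = t * s)
    (sr : s * r * s = r * s * r) (tr : t * r * t = r * t * r) (z : M) :
    t * (r * (s * (t * (r * z)))) = r * (s * (t * (r * (s * z)))) ∧
      t * (r * (s * (r * (t * z)))) = s * (r * (t * (r * (s * z)))) := by
  have st' (z : M) : s * (t * z) = t * (s * z) := by simp only [← mul_assoc, st]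
  have sr' (z : M) : s * (r * (s * z)) = r * (s * (r * z)) := by simp only [← mul_assoc, sr]
  have tr' (z : M) : t * (r * (t * z)) = r * (t * (r * z)) := by simp only [← mul_assoc, tr]
  constructor
  · rw [st' (r * z), tr', ← sr' z, ← st']
  · rw [← sr', ← st', st' z, tr']

theorem word_eq_of_braid_comm_braid {M : Type*} [Monoid M] {s t r : M}
    (st : s * t * s = t * s * t) (sr : s * r = r * s) (tr : t * r * t = r * t * r) (w : M) :
    t * (s * (r * (t * (s * w)))) = r * (t * (r * (s * (t * w)))) ∧
      t * (r * (s * (t * (r * w)))) = s * (t * (r * (s * (t * w)))) := by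
  have st' (z : M) : s * (t * (s * z)) = t * (s * (t * z)) := by simp only [← mul_assoc, st]
  have sr' (z : M) : s * (r * z) = r * (s * z) := by simp only [← mul_assoc, sr]
  have tr' (z : M) : t * (r * (t * z)) = r * (t * (r * z)) := by simp only [← mul_assoc, tr]
  constructor
  · rw [sr', st', tr']
  · rw [← sr', ← tr', ← st', sr']

theorem HasLCMBelow.trans_of_adj_of_not_adj {N : ℕ} (hN : HasLCMBelow m N) {i j k : Fin m}
    (hij : i ≠ j) (hik : i ≠ k) (haij : ¬ Adj i j) (hajk : Adj j k)
    {a b e : BraidMonoid m} (hb : length b ≤ N)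
    (h₁ : FactorsThroughLCM i j a b) (h₂ : FactorsThroughLCM j k b e) :
    FactorsThroughLCM i k a e := by
  obtain ⟨c, rfl, rfl⟩ := (factorsThroughLCM_of_not_adj hij haij).1 h₁
  obtain ⟨d, hcd, rfl⟩ := (factorsThroughLCM_of_adj hajk).1 h₂
  have st := gen_comm haij
  have tr := gen_braid hajk
  have hlen := congrArg length hcd
  simp only [length_mul, length_gen] at hlen hb
  by_cases haik : Adj i k
  · have sr := gen_braid haik
    obtain ⟨x, rfl, hx⟩ := (factorsThroughLCM_of_adj haik).1 (hN i k _ _ (by omega) hcd)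
    simp only [length_mul, length_gen] at hlen hb
    obtain ⟨y, rfl, hy⟩ := (factorsThroughLCM_of_not_adj hij.symm (fun h => haij h.symm)).1
      (hN j i _ _ (by omega) hx)
    obtain ⟨z, rfl, rfl⟩ := (factorsThroughLCM_of_adj hajk.symm).1 (hN k j _ _ (by omega) hy)
    refine (factorsThroughLCM_of_adj haik).2 ⟨gen j * (gen k * (gen i * z)),
      word_eq_of_comm_braid_braid st sr tr z⟩
  · have sr := gen_comm haik
    obtain ⟨x, rfl, hx⟩ := (factorsThroughLCM_of_not_adj hik haik).1 (hN i k _ _ (by omega) hcd)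
    simp only [length_mul, length_gen] at hlen hb
    obtain ⟨y, rfl, rfl⟩ := (factorsThroughLCM_of_not_adj hij.symm (fun h => haij h.symm)).1
      (hN j i _ _ (by omega) hx)
    refine (factorsThroughLCM_of_not_adj hik haik).2 ⟨gen j * (gen k * y), ?_, ?_⟩ <;> grind

theorem HasLCMBelow.trans {N : ℕ} (hN : HasLCMBelow m N) {i j k : Fin m}
    {a b e : BraidMonoid m} (hb : length b ≤ N)
    (h₁ : FactorsThroughLCM i j a b) (h₂ : FactorsThroughLCM j k b e) :
    FactorsThroughLCM i k a e := by
  by_cases hij : i = j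
  · subst hij; rwa [factorsThroughLCM_self_iff.1 h₁]
  by_cases hjk : j = k
  · subst hjk; rwa [← factorsThroughLCM_self_iff.1 h₂]
  by_cases hik : i = k
  · subst hik
    obtain ⟨c, rfl, rfl⟩ := h₁
    obtain ⟨d, hcd, rfl⟩ := h₂
    rw [hN.cancel_compl j i hb hcd]
    exact factorsThroughLCM_self _ _
  by_cases haij : Adj i j <;> by_cases hajk : Adj j k
  · have haik : ¬ Adj i k := by unfold Adj at *; omega
    obtain ⟨c, rfl, rfl⟩ := (factorsThroughLCM_of_adj haij).1 h₁
    obtain ⟨d, hcd, rfl⟩ := (factorsThroughLCM_of_adj hajk).1 h₂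
    have st := gen_braid haij
    have tr := gen_braid hajk
    have sr := gen_comm haik
    have hlen := congrArg length hcd
    simp only [length_mul, length_gen] at hlen hb
    obtain ⟨x, hx, hx'⟩ := (factorsThroughLCM_of_not_adj hik haik).1
      (hN i k _ _ (by simp; omega) hcd)
    obtain ⟨y, rfl, rfl⟩ := (factorsThroughLCM_of_adj hajk).1 (hN j k _ _ (by omega) hx)
    obtain ⟨z, rfl, hz⟩ := (factorsThroughLCM_of_adj haij.symm).1 (hN j i _ _ (by omega) hx')
    simp only [length_mul, length_gen] at hlen hb
    have hyz := hN.cancel (by simp; omega) hz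
    obtain ⟨w, rfl, rfl⟩ := (factorsThroughLCM_of_not_adj (Ne.symm hik)
      (fun h => haik h.symm)).1 (hN k i _ _ (by omega) hyz)
    refine (factorsThroughLCM_of_not_adj hik haik).2
      ⟨gen j * (gen k * (gen i * (gen j * w))), word_eq_of_braid_comm_braid st sr tr w⟩
  · exact (hN.trans_of_adj_of_not_adj (Ne.symm hjk) (Ne.symm hik) (fun h => hajk h.symm)
      haij.symm hb h₂.symm h₁.symm).symm
  · exact hN.trans_of_adj_of_not_adj hij hik haij hajk hb h₁ h₂
  · obtain ⟨c, rfl, rfl⟩ := (factorsThroughLCM_of_not_adj hij haij).1 h₁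
    obtain ⟨d, hcd, rfl⟩ := (factorsThroughLCM_of_not_adj hjk hajk).1 h₂
    simp only [length_mul, length_gen] at hb
    obtain ⟨x, rfl, rfl⟩ := hN i k _ _ (by omega) hcd
    have hji : Commute (gen j) (gen i) := (gen_comm haij).symm
    have hjk' : Commute (gen j) (gen k) := gen_comm hajk
    refine ⟨gen j * x, ?_, ?_⟩
    · rw [← mul_assoc, (commute_compl hji hjk').eq, mul_assoc]
    · rw [← mul_assoc, (commute_compl hjk' hji).eq, mul_assoc]

theorem factorsThroughLCM_of_rel {i j : Fin m} {x y : FreeMonoid (Fin m)}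
    (h : braidMonoidRels m (.of i * x) (.of j * y)) :
    FactorsThroughLCM i j (PresentedMonoid.mk _ x) (PresentedMonoid.mk _ y) := by
  obtain ⟨k, l, ⟨hkl, hx, hy⟩ | ⟨hkl, hx, hy⟩⟩ := h
  · obtain ⟨rfl, rfl⟩ : i = k ∧ x = .of l * .of k := List.cons.inj hx
    obtain ⟨rfl, rfl⟩ : j = l ∧ y = .of i * .of l := List.cons.inj hy
    exact (factorsThroughLCM_of_adj (.inl hkl)).2 ⟨1, rfl, rfl⟩
  · obtain ⟨rfl, rfl⟩ : i = k ∧ x = .of l := List.cons.inj hx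
    obtain ⟨rfl, rfl⟩ : j = l ∧ y = .of i := List.cons.inj hy
    refine (factorsThroughLCM_of_not_adj ?_ ?_).2 ⟨1, (mul_one _).symm, (mul_one _).symm⟩
    · rintro rfl; omega
    · unfold Adj; omega

theorem length_mk (x : FreeMonoid (Fin m)) :
    length (PresentedMonoid.mk (braidMonoidRels m) x) = x.length := by
  induction x with
  | one => rfl
  | of x => rfl
  | mul x y hx hy => rw [map_mul, length_mul, hx, hy, FreeMonoid.length_mul]

theorem freeMonoid_eq_one_or {α : Type*} (x : FreeMonoid α) : x = 1 ∨ ∃ i y, x = .of i * y := by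
  cases x using FreeMonoid.casesOn with
  | one => exact .inl rfl
  | of_mul i y => exact .inr ⟨i, y, rfl⟩

theorem HasLCMBelow.of_conGen {N : ℕ} (hN : HasLCMBelow m N) {x y : FreeMonoid (Fin m)}
    (h : conGen (braidMonoidRels m) x y) :
    ∀ i j x' y', x = .of i * x' → y = .of j * y' → x'.length ≤ N →
      FactorsThroughLCM i j (PresentedMonoid.mk _ x') (PresentedMonoid.mk _ y') := by
  have key : ∀ {x y}, ConGen.Rel (braidMonoidRels m) x y → x.length = y.length := fun h => by
    rw [← length_mk, ← length_mk]; exact congrArg _ (PresentedMonoid.mk_eq_mk_iff.2 h)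
  change ConGen.Rel (braidMonoidRels m) x y at h
  induction h with
  | of x y h =>
    rintro i j x' y' rfl rfl -
    exact factorsThroughLCM_of_rel h
  | refl x =>
    rintro i j x' y' rfl hy -
    obtain ⟨rfl, rfl⟩ : i = j ∧ x' = y' := List.cons.inj hy
    exact factorsThroughLCM_self _ _
  | symm h ih =>
    rintro i j x' y' rfl rfl hx
    have := key h
    simp only [FreeMonoid.length_mul, FreeMonoid.length_of] at this
    exact (ih j i y' x' rfl rfl (by omega)).symm
  | @trans x y z h h' ih ih' =>
    rintro i j x' y' rfl rfl hx
    have hl := key h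
    rcases freeMonoid_eq_one_or y with rfl | ⟨k, z, rfl⟩
    · simp at hl
    simp only [FreeMonoid.length_mul, FreeMonoid.length_of] at hl
    exact hN.trans (by rw [length_mk]; omega) (ih i k x' z rfl rfl hx)
      (ih' k j z y' rfl rfl (by omega))
  | @mul w x y z h h' ih ih' =>
    intro i j x' y' hx hy hl
    have hwx := key h
    rcases freeMonoid_eq_one_or w with rfl | ⟨k, w', rfl⟩
    · obtain rfl : x = 1 := FreeMonoid.length_eq_zero.1 hwx.symm
      exact ih' i j x' y' (by simpa using hx) (by simpa using hy) hl
    rcases freeMonoid_eq_one_or x with rfl | ⟨l, z', rfl⟩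
    · simp at hwx
    obtain ⟨rfl, rfl⟩ : k = i ∧ w' * y = x' := List.cons.inj hx
    obtain ⟨rfl, rfl⟩ : l = j ∧ z' * z = y' := List.cons.inj hy
    obtain ⟨c, hc, hc'⟩ := ih k l w' z' rfl rfl
      (by simp only [FreeMonoid.length_mul] at hl; omega)
    refine ⟨c * PresentedMonoid.mk _ y, ?_, ?_⟩
    · rw [map_mul, hc, mul_assoc]
    · rw [map_mul, hc', mul_assoc, PresentedMonoid.mk_eq_mk_iff.2 h']

theorem hasLCMBelow (m N : ℕ) : HasLCMBelow m N := by
  induction N with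
  | zero => intro i j a b h; omega
  | succ N ih =>
    intro i j a b ha hab
    induction a using PresentedMonoid.inductionOn with | _ x
    induction b using PresentedMonoid.inductionOn with | _ y
    refine ih.of_conGen (PresentedMonoid.mk_eq_mk_iff.1 ?_) i j x y rfl rfl ?_
    · simpa [gen, PresentedMonoid.of] using hab
    · rw [length_mk] at ha; omega

/-- Garside's lemma: every common multiple of two generators is a multiple of their least
common multiple. -/
theorem factorsThroughLCM {i j : Fin m} {a b : BraidMonoid m} (h : gen i * a = gen j * b) :
    FactorsThroughLCM i j a b :=
  hasLCMBelow m (length a + 1) i j a b (Nat.lt_succ_self _) h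

@[elab_as_elim]
theorem gen_mul_induction {motive : BraidMonoid m → Prop} (one : motive 1)
    (gen_mul : ∀ i a, motive a → motive (gen i * a)) (a : BraidMonoid m) : motive a := by
  induction h : length a generalizing a with
  | zero =>
    rcases eq_one_or_gen_mul a with rfl | ⟨i, b, rfl⟩
    · exact one
    · simp at h
  | succ N ih =>
    rcases eq_one_or_gen_mul a with rfl | ⟨i, b, rfl⟩
    · exact one
    · refine gen_mul i b (ih b ?_)
      simp only [length_mul, length_gen] at h
      omega

theorem mul_left_cancel' (a : BraidMonoid m) {b c : BraidMonoid m} (h : a * b = a * c) :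
    b = c := by
  induction a using gen_mul_induction with
  | one => simpa using h
  | gen_mul i a ih =>
    rw [mul_assoc, mul_assoc] at h
    exact ih (factorsThroughLCM_self_iff.1 (factorsThroughLCM h))

/-- A common left divisor of `p * u` and `p * v` left-divides `p * q` for some common left
divisor `q` of `u` and `v`. -/
theorem exists_dvd_mul_of_dvd_mul {c p u v : BraidMonoid m} (hu : c ∣ p * u) (hv : c ∣ p * v) :
    ∃ q, c ∣ p * q ∧ q ∣ u ∧ q ∣ v := by
  induction h : length (p * u) using Nat.strong_induction_on generalizing c p u v with
  | _ N ih
  subst h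
  rcases eq_one_or_gen_mul p with rfl | ⟨i, p, rfl⟩
  · exact ⟨c, by simp, by simpa using hu, by simpa using hv⟩
  rcases eq_one_or_gen_mul c with rfl | ⟨j, c, rfl⟩
  · exact ⟨1, one_dvd _, one_dvd _, one_dvd _⟩
  obtain ⟨x, hx⟩ := hu
  obtain ⟨y, hy⟩ := hv
  simp only [mul_assoc] at hx hy
  obtain ⟨x', hx₁, hx₂⟩ := factorsThroughLCM hx
  obtain ⟨y', hy₁, hy₂⟩ := factorsThroughLCM hy
  have hlen := congrArg length hx
  simp only [length_mul, length_gen] at hlen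
  obtain ⟨q, hq, hqx, hqy⟩ := ih (length (compl j i * x'))
    (by rw [← hx₂]; simp only [length_mul, length_gen]; omega)
    ⟨x, hx₂.symm⟩ ⟨y, hy₂.symm⟩ rfl
  obtain ⟨r, hr, hru, hrv⟩ := ih (length (p * u))
    (by simp only [length_mul, length_gen]; omega)
    (hx₁ ▸ mul_dvd_mul_left (compl i j) hqx) (hy₁ ▸ mul_dvd_mul_left (compl i j) hqy) rfl
  refine ⟨r, ?_, hru, hrv⟩
  rw [mul_assoc]
  calc gen j * c ∣ gen j * (compl j i * q) := mul_dvd_mul_left _ hq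
    _ = gen i * (compl i j * q) := by rw [← mul_assoc, gen_mul_compl, mul_assoc]
    _ ∣ gen i * (p * r) := mul_dvd_mul_left _ hr

/-- The product of the first `k` generators. -/
def partialCoxeter (m : ℕ) : ℕ → BraidMonoid m
  | 0 => 1
  | k + 1 => partialCoxeter m k * if h : k < m then gen ⟨k, h⟩ else 1

theorem partialCoxeter_succ {k : ℕ} (h : k < m) :
    partialCoxeter m (k + 1) = partialCoxeter m k * gen ⟨k, h⟩ := by
  simp [partialCoxeter, h]

theorem gen_mul_partialCoxeter {k i : ℕ} (hi : i < m) (hk : k < i) :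
    gen ⟨i, hi⟩ * partialCoxeter m k = partialCoxeter m k * gen ⟨i, hi⟩ := by
  induction k with
  | zero => simp [partialCoxeter]
  | succ k ih =>
    have hc : gen ⟨i, hi⟩ * gen ⟨k, by omega⟩ = gen ⟨k, by omega⟩ * gen ⟨i, hi⟩ :=
      gen_comm (by simp only [Adj]; omega)
    rw [partialCoxeter_succ (by omega), ← mul_assoc, ih (by omega), mul_assoc, hc, mul_assoc]

theorem partialCoxeter_mul_gen {k i : ℕ} (hk : k ≤ m) (hi : i + 1 < k) :
    partialCoxeter m k * gen ⟨i, by omega⟩ = gen ⟨i + 1, by omega⟩ * partialCoxeter m k := by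
  induction k with
  | zero => omega
  | succ k ih =>
    rcases Nat.lt_or_ge (i + 1) k with h | h
    · have hc : gen ⟨k, hk⟩ * gen ⟨i, by omega⟩ = gen ⟨i, by omega⟩ * gen ⟨k, hk⟩ :=
        gen_comm (by simp only [Adj]; omega)
      rw [partialCoxeter_succ hk, mul_assoc, hc, ← mul_assoc, ih (by omega) h, mul_assoc]
    · obtain rfl : k = i + 1 := by omega
      have hb : gen ⟨i, by omega⟩ * gen ⟨i + 1, hk⟩ * gen ⟨i, by omega⟩ =
          gen ⟨i + 1, hk⟩ * gen ⟨i, by omega⟩ * gen ⟨i + 1, hk⟩ := gen_braid (.inl rfl)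
      have hc := gen_mul_partialCoxeter (k := i) hk (by omega)
      rw [partialCoxeter_succ hk, partialCoxeter_succ (by omega)]
      simp only [mul_assoc] at hb ⊢
      rw [hb, ← mul_assoc, ← hc, mul_assoc]

/-- The product of all generators in order. -/
def coxeter (m : ℕ) : BraidMonoid m := partialCoxeter m m

theorem coxeter_mul_gen {i : ℕ} (hi : i + 1 < m) :
    coxeter m * gen ⟨i, by omega⟩ = gen ⟨i + 1, hi⟩ * coxeter m :=
  partialCoxeter_mul_gen le_rfl hi

theorem coxeter_pow_mul_gen {k i : ℕ} (hi : i + k < m) :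
    coxeter m ^ k * gen ⟨i, by omega⟩ = gen ⟨i + k, hi⟩ * coxeter m ^ k := by
  induction k with
  | zero => simp
  | succ k ih =>
    rw [pow_succ', mul_assoc, ih (by omega), ← mul_assoc, coxeter_mul_gen (by omega), mul_assoc]
    rfl

theorem coxeter_mul_partialCoxeter {k : ℕ} (hk : k < m) :
    gen ⟨0, by omega⟩ * (coxeter m * partialCoxeter m k) =
      partialCoxeter m (k + 1) * coxeter m := by
  induction k with
  | zero => simp [partialCoxeter, show 0 < m by omega]
  | succ k ih =>
    rw [partialCoxeter_succ (by omega : k < m), ← mul_assoc, ← mul_assoc, mul_assoc (gen _),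
      ih (by omega), mul_assoc, coxeter_mul_gen hk, ← mul_assoc, ← partialCoxeter_succ hk]

theorem coxeter_sq_mul_gen_last (hm : 0 < m) :
    coxeter m ^ 2 * gen ⟨m - 1, by omega⟩ = gen ⟨0, hm⟩ * coxeter m ^ 2 := by
  obtain ⟨k, rfl⟩ : ∃ k, m = k + 1 := ⟨m - 1, by omega⟩
  have h := coxeter_mul_partialCoxeter (m := k + 1) (k := k) (by omega)
  have hc : coxeter (k + 1) = partialCoxeter (k + 1) k * gen ⟨k, by omega⟩ :=
    partialCoxeter_succ (by omega)
  calc coxeter (k + 1) ^ 2 * gen ⟨k, by omega⟩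
      = gen ⟨0, hm⟩ * (coxeter (k + 1) * partialCoxeter (k + 1) k) * gen ⟨k, by omega⟩ := by
        rw [h, sq, coxeter]
    _ = gen ⟨0, hm⟩ * (coxeter (k + 1) * (partialCoxeter (k + 1) k * gen ⟨k, by omega⟩)) := by
        simp only [mul_assoc]
    _ = gen ⟨0, hm⟩ * coxeter (k + 1) ^ 2 := by rw [← hc, sq]

/-- The full twist, a central element of the braid monoid. -/
def fullTwist (m : ℕ) : BraidMonoid m := coxeter m ^ (m + 1)

theorem fullTwist_commute_gen (i : Fin m) : fullTwist m * gen i = gen i * fullTwist m := by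
  obtain ⟨i, hi⟩ := i
  have hpow : fullTwist m = coxeter m ^ i * (coxeter m ^ 2 * coxeter m ^ (m - 1 - i)) := by
    rw [fullTwist, ← pow_add, ← pow_add]; congr 1; omega
  have h₁ := coxeter_pow_mul_gen (m := m) (k := m - 1 - i) (i := i) (by omega)
  have h₂ := coxeter_sq_mul_gen_last (m := m) (by omega)
  have h₃ := coxeter_pow_mul_gen (m := m) (k := i) (i := 0) (by omega)
  simp only [show i + (m - 1 - i) = m - 1 by omega] at h₁
  simp only [Nat.zero_add] at h₃
  rw [hpow, mul_assoc, mul_assoc, h₁, ← mul_assoc (coxeter m ^ 2), h₂, mul_assoc, ← mul_assoc,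
    h₃, mul_assoc]

theorem fullTwist_commute (a : BraidMonoid m) : Commute (fullTwist m) a := by
  induction a using gen_mul_induction with
  | one => exact Commute.one_right _
  | gen_mul i a ih => exact Commute.mul_right (fullTwist_commute_gen i) ih

theorem gen_zero_dvd_partialCoxeter (hm : 0 < m) (k : ℕ) :
    gen ⟨0, hm⟩ ∣ partialCoxeter m (k + 1) := by
  induction k with
  | zero => simp [partialCoxeter, hm]
  | succ k ih => exact ih.mul_right _

theorem gen_dvd_fullTwist (i : Fin m) : gen i ∣ fullTwist m := by
  obtain ⟨i, hi⟩ := i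
  have h := coxeter_pow_mul_gen (m := m) (k := i) (i := 0) (by omega)
  simp only [Nat.zero_add] at h
  obtain ⟨k, rfl⟩ : ∃ k, m = k + 1 := ⟨m - 1, by omega⟩
  obtain ⟨d, hd⟩ : gen ⟨0, by omega⟩ ∣ coxeter (k + 1) := gen_zero_dvd_partialCoxeter (by omega) k
  have hpow : fullTwist (k + 1) =
      coxeter (k + 1) ^ i * (coxeter (k + 1) * coxeter (k + 1) ^ (k + 1 - i)) := by
    rw [fullTwist, ← pow_succ', ← pow_add]; congr 1; omega
  refine ⟨coxeter (k + 1) ^ i * (d * coxeter (k + 1) ^ (k + 1 - i)), ?_⟩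
  rw [hpow]
  nth_rewrite 2 [hd]
  rw [mul_assoc (gen _), ← mul_assoc, h, mul_assoc]

theorem exists_mul_eq_fullTwist_pow (a : BraidMonoid m) :
    ∃ b k, a * b = fullTwist m ^ k := by
  induction a using gen_mul_induction with
  | one => exact ⟨1, 0, by simp⟩
  | gen_mul i a ih =>
    obtain ⟨b, k, hb⟩ := ih
    obtain ⟨d, hd⟩ := gen_dvd_fullTwist i
    refine ⟨b * d, k + 1, ?_⟩
    rw [mul_assoc, ← mul_assoc a, hb, ((fullTwist_commute d).pow_left k).eq, ← mul_assoc,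
      ← hd, pow_succ']

theorem exists_mul_eq_fullTwist_pow' (a : BraidMonoid m) :
    ∃ b k, b * a = fullTwist m ^ k := by
  obtain ⟨b, k, hb⟩ := exists_mul_eq_fullTwist_pow a
  refine ⟨b, k, mul_left_cancel' a ?_⟩
  rw [← mul_assoc, hb, ((fullTwist_commute a).pow_left k).eq]

theorem mul_right_cancel' (a : BraidMonoid m) {b c : BraidMonoid m} (h : b * a = c * a) :
    b = c := by
  obtain ⟨d, k, hd⟩ := exists_mul_eq_fullTwist_pow a
  have h' := congrArg (· * d) h
  simp only [mul_assoc, hd] at h'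
  rw [← ((fullTwist_commute b).pow_left k).eq, ← ((fullTwist_commute c).pow_left k).eq] at h'
  exact mul_left_cancel' _ h'

theorem exists_ore (r s : BraidMonoid m) : ∃ r' s', s' * r = r' * s := by
  obtain ⟨b, k, hb⟩ := exists_mul_eq_fullTwist_pow' s
  refine ⟨r * b, fullTwist m ^ k, ?_⟩
  rw [mul_assoc, hb, ((fullTwist_commute r).pow_left k).eq]

noncomputable instance : OreLocalization.OreSet (⊤ : Submonoid (BraidMonoid m)) where
  ore_right_cancel r₁ r₂ s h := ⟨1, by rw [mul_right_cancel' _ h]⟩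
  oreNum r s := (exists_ore r s).choose
  oreDenom r s := ⟨(exists_ore r s).choose_spec.choose, trivial⟩
  ore_eq r s := (exists_ore r s).choose_spec.choose_spec

theorem numeratorHom_injective : Function.Injective
    (OreLocalization.numeratorHom : BraidMonoid m →*
      OreLocalization (⊤ : Submonoid (BraidMonoid m)) (BraidMonoid m)) := by
  intro a b h
  obtain ⟨u, v, h₁, h₂⟩ := OreLocalization.oreDiv_eq_iff.1 h
  have huv : (u : BraidMonoid m) = v := by simpa using h₂
  rw [Submonoid.smul_def, smul_eq_mul, smul_eq_mul, huv] at h₁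
  exact (mul_left_cancel' v h₁).symm

/-- The canonical homomorphism from the braid monoid to the braid group. -/
def toBraidGroup (n : ℕ) : BraidMonoid (n - 1) →* BraidGroup n :=
  PresentedMonoid.lift (braidGen n) (by
    rintro a b ⟨i, j, ⟨h, rfl, rfl⟩ | ⟨h, rfl, rfl⟩⟩
    · simp only [map_mul, FreeMonoid.lift_eval_of]
      exact mul_inv_eq_one.1 (PresentedGroup.one_of_mem (rels := braidRels n)
        (.inl ⟨i, j, h, rfl⟩))
    · simp only [map_mul, FreeMonoid.lift_eval_of]
      exact mul_inv_eq_one.1 (PresentedGroup.one_of_mem (rels := braidRels n)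
        (.inr ⟨i, j, h, rfl⟩)))

theorem toBraidGroup_gen {n : ℕ} (i : Fin (n - 1)) : toBraidGroup n (gen i) = braidGen n i := rfl

theorem mrange_toBraidGroup (n : ℕ) : MonoidHom.mrange (toBraidGroup n) = PosBraid n := by
  rw [MonoidHom.mrange_eq_map, ← PresentedMonoid.closure_range_of, MonoidHom.map_mclosure,
    ← Set.range_comp]
  rfl

/-- The homomorphism from the braid group to the units of the localization of the braid monoid. -/
noncomputable def ofBraidGroup (n : ℕ) : BraidGroup n →*
    (OreLocalization (⊤ : Submonoid (BraidMonoid (n - 1))) (BraidMonoid (n - 1)))ˣ :=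
  PresentedGroup.toGroup
    (f := fun i => OreLocalization.numeratorUnit (⟨gen i, trivial⟩ : (⊤ : Submonoid _))) (by
    rintro r (⟨i, j, h, rfl⟩ | ⟨i, j, h, rfl⟩) <;>
      simp only [map_mul, map_inv, FreeGroup.lift_apply_of] <;>
      refine mul_inv_eq_one.2 (Units.ext ?_)
    · change OreLocalization.numeratorHom _ * OreLocalization.numeratorHom _ *
        OreLocalization.numeratorHom _ = OreLocalization.numeratorHom _ *
        OreLocalization.numeratorHom _ * OreLocalization.numeratorHom _
      simp only [← map_mul, gen_braid (.inl h : Adj i j)]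
    · change OreLocalization.numeratorHom _ * OreLocalization.numeratorHom _ =
        OreLocalization.numeratorHom _ * OreLocalization.numeratorHom _
      simp only [← map_mul, gen_comm (show ¬ Adj i j by unfold Adj; omega)])

theorem ofBraidGroup_toBraidGroup {n : ℕ} (a : BraidMonoid (n - 1)) :
    (ofBraidGroup n (toBraidGroup n a) : OreLocalization (⊤ : Submonoid (BraidMonoid (n - 1)))
      (BraidMonoid (n - 1))) = OreLocalization.numeratorHom a := by
  induction a using gen_mul_induction with
  | one => simp only [map_one, Units.val_one]
  | gen_mul i a ih =>
    rw [map_mul, map_mul, Units.val_mul, ih, map_mul, toBraidGroup_gen, braidGen, ofBraidGroup,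
      PresentedGroup.toGroup.of]
    rfl

theorem toBraidGroup_injective (n : ℕ) : Function.Injective (toBraidGroup n) := fun a b h =>
  numeratorHom_injective (by
    rw [← ofBraidGroup_toBraidGroup, ← ofBraidGroup_toBraidGroup, h])

theorem prefixLE_toBraidGroup_iff {n : ℕ} {a b : BraidMonoid (n - 1)} :
    PrefixLE n (toBraidGroup n a) (toBraidGroup n b) ↔ a ∣ b := by
  rw [PrefixLE, ← mrange_toBraidGroup]
  constructor
  · rintro ⟨_, ⟨c, rfl⟩, h⟩
    exact ⟨c, toBraidGroup_injective n (by rw [map_mul, h])⟩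
  · rintro ⟨c, rfl⟩
    exact ⟨_, ⟨c, rfl⟩, (map_mul _ _ _).symm⟩

end BraidMonoid

/-- left multiplication in `B_n⁺` preserves greatest common
left-divisors: if `d` is a gcd of `u` and `v`, then `p d` is a gcd of `p u` and `p v`. -/
theorem stmt11 (n : ℕ) (hn : 2 ≤ n) (p u v d : BraidGroup n)
    (hp : p ∈ PosBraid n) (hu : u ∈ PosBraid n) (hv : v ∈ PosBraid n)
    (hd : IsGCD n u v d) :
    IsGCD n (p * u) (p * v) (p * d) := by
  obtain ⟨hd, hdu, hdv, hmax⟩ := hd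
  rw [← BraidMonoid.mrange_toBraidGroup] at hp hu hv hd
  obtain ⟨p, rfl⟩ := hp
  obtain ⟨u, rfl⟩ := hu
  obtain ⟨v, rfl⟩ := hv
  obtain ⟨d, rfl⟩ := hd
  rw [BraidMonoid.prefixLE_toBraidGroup_iff] at hdu hdv
  simp only [IsGCD, ← map_mul, BraidMonoid.prefixLE_toBraidGroup_iff]
  refine ⟨?_, mul_dvd_mul_left p hdu, mul_dvd_mul_left p hdv, ?_⟩
  · rw [← BraidMonoid.mrange_toBraidGroup]
    exact ⟨_, rfl⟩
  intro c hc hcu hcv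
  rw [← BraidMonoid.mrange_toBraidGroup] at hc
  obtain ⟨c, rfl⟩ := hc
  rw [BraidMonoid.prefixLE_toBraidGroup_iff] at hcu hcv ⊢
  obtain ⟨q, hq, hqu, hqv⟩ := BraidMonoid.exists_dvd_mul_of_dvd_mul hcu hcv
  refine hq.trans (mul_dvd_mul_left p (BraidMonoid.prefixLE_toBraidGroup_iff.1 (hmax _ ?_ ?_ ?_)))
  · rw [← BraidMonoid.mrange_toBraidGroup]
    exact ⟨q, rfl⟩
  · exact BraidMonoid.prefixLE_toBraidGroup_iff.2 hqu
  · exact BraidMonoid.prefixLE_toBraidGroup_iff.2 hqv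
end

section
/- Let j ∈ ℤ, p ∈ B_n^+, and let s and r be simple elements with s ≼ r. Suppose τ^j(r) ≼ p r in B_n^+. Then τ^j(s) ≼ p r and p s ≼ p r; consequently, every least common left-multiple m of τ^j(s) and p s satisfies m ≼ p r, and the element s' ∈ B_n^+ defined by (p s) s' = m is such that s s' is again a simple element with s s' ≼ r. Moreover, if in addition τ^j(s) does not left-divide p s, then s' ≠ 1. -/
section HalfTwist

variable {G : Type*} [Monoid G] (g : ℕ → G)

/-- The descending product `g (k - 1) * ⋯ * g 1 * g 0`. -/
def descProd : ℕ → G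
  | 0 => 1
  | k + 1 => g k * descProd k

/-- The half-twist `descProd g 1 * ⋯ * descProd g m` of a sequence in a monoid. -/
def halfTwist : ℕ → G
  | 0 => 1
  | m + 1 => halfTwist m * descProd g (m + 1)

theorem descProd_eq_list_prod (k : ℕ) :
    descProd g k = ((List.range k).reverse.map g).prod := by
  induction k with
  | zero => rfl
  | succ k ih => simp [descProd, ih, List.range_succ]

theorem halfTwist_eq_list_prod (m : ℕ) :
    halfTwist g m = ((List.range m).map fun k => descProd g (k + 1)).prod := by
  induction m with
  | zero => rfl
  | succ m ih => simp [halfTwist, ih, List.range_succ]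

variable {g} {N : ℕ}

theorem commute_descProd (hc : ∀ i j, i + 1 < j → j < N → Commute (g i) (g j))
    {k j : ℕ} (hkj : k < j) (hj : j < N) : Commute (g j) (descProd g k) := by
  induction k with
  | zero => exact Commute.one_right _
  | succ k ih => exact ((hc k j hkj hj).symm).mul_right (ih (by lia))

theorem commute_halfTwist (hc : ∀ i j, i + 1 < j → j < N → Commute (g i) (g j))
    {m j : ℕ} (hmj : m < j) (hj : j < N) : Commute (g j) (halfTwist g m) := by
  induction m with
  | zero => exact Commute.one_right _
  | succ m ih => exact (ih (by lia)).mul_right (commute_descProd hc hmj hj)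

theorem descProd_mul_gen (hc : ∀ i j, i + 1 < j → j < N → Commute (g i) (g j))
    (hb : ∀ i, i + 1 < N → g i * g (i + 1) * g i = g (i + 1) * g i * g (i + 1))
    {k i : ℕ} (hik : i + 1 < k) (hk : k ≤ N) :
    descProd g k * g (i + 1) = g i * descProd g k := by
  induction k, hik using Nat.le_induction with
  | base =>
    have hcomm := (commute_descProd (k := i) (j := i + 1) hc (by lia) (by lia)).eq
    simp only [descProd, mul_assoc]
    rw [← hcomm]
    simp only [← mul_assoc]
    rw [hb i (by lia)]
  | succ k hik ih =>
    simp only [descProd]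
    rw [mul_assoc, ih (by lia), ← mul_assoc, ← (hc i k (by lia) (by lia)).eq, mul_assoc]

theorem descProd_mul_descProd (hc : ∀ i j, i + 1 < j → j < N → Commute (g i) (g j))
    (hb : ∀ i, i + 1 < N → g i * g (i + 1) * g i = g (i + 1) * g i * g (i + 1))
    {m k : ℕ} (hkm : k < m) (hm : m ≤ N) :
    descProd g m * descProd g (k + 1) = descProd g k * descProd g m * g 0 := by
  induction k with
  | zero => simp [descProd]
  | succ k ih =>
    rw [descProd, ← mul_assoc, descProd_mul_gen hc hb hkm hm, mul_assoc, ih (by lia)]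
    simp only [descProd, mul_assoc]

theorem halfTwist_mul_gen_zero (hc : ∀ i j, i + 1 < j → j < N → Commute (g i) (g j))
    (hb : ∀ i, i + 1 < N → g i * g (i + 1) * g i = g (i + 1) * g i * g (i + 1))
    {m : ℕ} (hm : m < N) :
    halfTwist g (m + 1) * g 0 = g m * halfTwist g (m + 1) := by
  cases m with
  | zero => simp [halfTwist, descProd]
  | succ m =>
    have hsq := descProd_mul_descProd (m := m + 2) (k := m + 1) hc hb (by lia) hm
    have hcomm := (commute_halfTwist (m := m) (j := m + 1) hc (by lia) hm).eq
    calc halfTwist g (m + 2) * g 0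
        = halfTwist g m * (descProd g (m + 1) * descProd g (m + 2) * g 0) := by
          simp only [halfTwist, mul_assoc]
      _ = halfTwist g m * g (m + 1) * (descProd g (m + 1) * descProd g (m + 2)) := by
          rw [← hsq, descProd]
          simp only [mul_assoc]
      _ = g (m + 1) * halfTwist g (m + 2) := by
          rw [← hcomm]
          simp only [halfTwist, mul_assoc]

theorem halfTwist_mul_gen (hc : ∀ i j, i + 1 < j → j < N → Commute (g i) (g j))
    (hb : ∀ i, i + 1 < N → g i * g (i + 1) * g i = g (i + 1) * g i * g (i + 1))
    {m i : ℕ} (him : i < m) (hm : m ≤ N) :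
    halfTwist g m * g i = g (m - 1 - i) * halfTwist g m := by
  induction m generalizing i with
  | zero => lia
  | succ m ih =>
    cases i with
    | zero => exact halfTwist_mul_gen_zero hc hb hm
    | succ i =>
      rw [halfTwist, mul_assoc, descProd_mul_gen hc hb him hm, ← mul_assoc,
        ih (by lia) (by lia), mul_assoc]
      congr 2
      lia

end HalfTwist

section Braid

variable {n : ℕ}

theorem braidGen_braid {i j : Fin (n - 1)} (h : (i : ℕ) + 1 = j) :
    braidGen n i * braidGen n j * braidGen n i = braidGen n j * braidGen n i * braidGen n j :=
  mul_inv_eq_one.1 (PresentedGroup.one_of_mem (rels := braidRels n) (Or.inl ⟨i, j, h, rfl⟩))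

theorem braidGen_commute {i j : Fin (n - 1)} (h : (i : ℕ) + 1 < j) :
    Commute (braidGen n i) (braidGen n j) :=
  mul_inv_eq_one.1 (PresentedGroup.one_of_mem (rels := braidRels n) (Or.inr ⟨i, j, h, rfl⟩))

variable (n) in
/-- The Artin generators extended to all natural indices by `1`. -/
def braidGenNat (i : ℕ) : BraidGroup n :=
  if h : i < n - 1 then braidGen n ⟨i, h⟩ else 1

theorem braidGenNat_of_lt {i : ℕ} (h : i < n - 1) : braidGenNat n i = braidGen n ⟨i, h⟩ :=
  dif_pos h

theorem braidGenNat_coe (i : Fin (n - 1)) : braidGenNat n i = braidGen n i :=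
  braidGenNat_of_lt i.2

theorem List.filter_range_le {k m : ℕ} (h : k < m) :
    (List.range m).filter (fun i => decide (i ≤ k)) = List.range (k + 1) := by
  induction m, h using Nat.le_induction with
  | base => exact List.filter_eq_self.2 fun a ha => by simp at ha ⊢; lia
  | succ m h ih =>
    rw [List.range_succ, List.filter_append, ih]
    simp
    lia

theorem braidDelta_eq_halfTwist : braidDelta n = halfTwist (braidGenNat n) (n - 1) := by
  rw [halfTwist_eq_list_prod, braidDelta, ← List.map_coe_finRange_eq_range, List.map_map]
  congr 2
  funext k
  rw [Function.comp_apply, descProd_eq_list_prod, ← List.filter_range_le k.2,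
    ← List.map_coe_finRange_eq_range, List.filter_map, ← List.map_reverse, List.map_map]
  congr 2
  funext i
  exact (braidGenNat_coe i).symm

theorem braidDelta_mul_braidGen (i : Fin (n - 1)) :
    braidDelta n * braidGen n i = braidGen n i.rev * braidDelta n := by
  have h := halfTwist_mul_gen (g := braidGenNat n) (N := n - 1) (m := n - 1) (i := i)
    (fun i j hij hj => by
      rw [braidGenNat_of_lt hj, braidGenNat_of_lt (by lia)]
      exact braidGen_commute hij)
    (fun i hi => by
      rw [braidGenNat_of_lt hi, braidGenNat_of_lt (by lia)]
      exact braidGen_braid rfl)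
    i.2 le_rfl
  rw [braidDelta_eq_halfTwist, ← braidGenNat_coe, h, ← braidGenNat_coe]
  congr 2
  rw [Fin.val_rev]
  lia

theorem braidDelta_inv_mul_mem {x : BraidGroup n} (hx : x ∈ PosBraid n) :
    (braidDelta n)⁻¹ * x * braidDelta n ∈ PosBraid n := by
  induction hx using Submonoid.closure_induction with
  | mem x hx =>
    obtain ⟨i, rfl⟩ := hx
    have h := braidDelta_mul_braidGen i.rev
    rw [Fin.rev_rev] at h
    rw [mul_assoc, ← h, inv_mul_cancel_left]
    exact Submonoid.subset_closure ⟨_, rfl⟩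
  | one => simp
  | mul x y _ _ hx hy => simpa [mul_assoc] using mul_mem hx hy

theorem braidDelta_mul_inv_mem {x : BraidGroup n} (hx : x ∈ PosBraid n) :
    braidDelta n * x * (braidDelta n)⁻¹ ∈ PosBraid n := by
  induction hx using Submonoid.closure_induction with
  | mem x hx =>
    obtain ⟨i, rfl⟩ := hx
    rw [braidDelta_mul_braidGen, mul_inv_cancel_right]
    exact Submonoid.subset_closure ⟨_, rfl⟩
  | one => simp
  | mul x y _ _ hx hy => simpa [mul_assoc] using mul_mem hx hy

theorem braidDelta_zpow_conj_mem {x : BraidGroup n} (hx : x ∈ PosBraid n) (j : ℤ) :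
    braidDelta n ^ (-j) * x * braidDelta n ^ j ∈ PosBraid n := by
  induction j with
  | zero => simpa using hx
  | succ j ih =>
    convert braidDelta_inv_mul_mem ih using 1
    group
  | pred j ih =>
    convert braidDelta_mul_inv_mem ih using 1
    group

theorem PrefixLE.trans {a b c : BraidGroup n} (hab : PrefixLE n a b) (hbc : PrefixLE n b c) :
    PrefixLE n a c := by
  obtain ⟨u, hu, rfl⟩ := hab
  obtain ⟨v, hv, rfl⟩ := hbc
  exact ⟨u * v, mul_mem hu hv, (mul_assoc a u v).symm⟩

theorem prefixLE_mul_left_iff {a b c : BraidGroup n} :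
    PrefixLE n (a * b) (a * c) ↔ PrefixLE n b c := by
  simp only [PrefixLE, mul_assoc, mul_right_inj]

theorem PrefixLE.braidDelta_zpow_conj {a b : BraidGroup n} (h : PrefixLE n a b) (j : ℤ) :
    PrefixLE n (braidDelta n ^ (-j) * a * braidDelta n ^ j)
      (braidDelta n ^ (-j) * b * braidDelta n ^ j) := by
  obtain ⟨c, hc, rfl⟩ := h
  refine ⟨_, braidDelta_zpow_conj_mem hc j, ?_⟩
  group

end Braid

/-- if `s ≼ r` are simple and `τ^j(r) ≼ p r`, then `τ^j(s) ≼ p r`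
and `p s ≼ p r`; every lcm `m` of `τ^j(s)` and `p s` satisfies `m ≼ p r`, and the
positive element `s'` with `(p s) s' = m` makes `s s'` a simple element with
`s s' ≼ r`; moreover if `τ^j(s)` does not left-divide `p s`, then `s' ≠ 1`. -/
theorem stmt12 (n : ℕ) (hn : 2 ≤ n) (j : ℤ) (p : BraidGroup n) (hp : p ∈ PosBraid n)
    (s r : BraidGroup n) (hs : IsSimple n s) (hr : IsSimple n r)
    (hsr : PrefixLE n s r)
    (hτr : PrefixLE n (braidDelta n ^ (-j) * r * braidDelta n ^ j) (p * r)) :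
    PrefixLE n (braidDelta n ^ (-j) * s * braidDelta n ^ j) (p * r) ∧
    PrefixLE n (p * s) (p * r) ∧
    ∀ m : BraidGroup n,
      IsLCM n (braidDelta n ^ (-j) * s * braidDelta n ^ j) (p * s) m →
      PrefixLE n m (p * r) ∧
      ∀ s' ∈ PosBraid n, (p * s) * s' = m →
        IsSimple n (s * s') ∧ PrefixLE n (s * s') r ∧
        (¬ PrefixLE n (braidDelta n ^ (-j) * s * braidDelta n ^ j) (p * s) → s' ≠ 1) := by
  have hτs := (hsr.braidDelta_zpow_conj j).trans hτr
  have hps : PrefixLE n (p * s) (p * r) := prefixLE_mul_left_iff.2 hsr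
  refine ⟨hτs, hps, fun m hm => ?_⟩
  obtain ⟨-, hτm, -, hmin⟩ := hm
  have hmr : PrefixLE n m (p * r) := hmin _ (mul_mem hp hr.1) hτs hps
  refine ⟨hmr, ?_⟩
  rintro s' hs' rfl
  have hss' : PrefixLE n (s * s') r := by
    rwa [mul_assoc, prefixLE_mul_left_iff] at hmr
  refine ⟨⟨mul_mem hs.1 hs', hss'.trans hr.2⟩, hss', ?_⟩
  rintro hndvd rfl
  exact hndvd (by rwa [mul_one] at hτm)
end
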